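/- Let H : ℝ → ℝ be continuous and coercive and F0 : ℝ → ℝ be continuous, non-increasing and semi-coercive. Suppose Φ : ℝ → ℝ satisfies: for every p ∈ ℝ there exists q ∈ ℝ with Φ(p) = F0(q) and F0(q) ∈ G̲(q,p). Then Φ is non-increasing, continuous, and semi-coercive (Φ(p) → +∞ as p → −∞). The same conclusion holds if instead for every p there exists q with Φ(p) = F0(q) and F0(q) ∈ Ḡ(q,p). -/

import Mathlib

open Set Filter

attribute [local instance] Classical.propDecidable

noncomputable section

/-- `H` is coercive: `H p → +∞` as `|p| → +∞`. -/
def Coercive (H : ℝ → ℝ) : Prop := Tendsto H (cocompact ℝ) atTop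

/-- `F` is semi-coercive: `F p → +∞` as `p → -∞`. -/
def SemiCoercive (F : ℝ → ℝ) : Prop := Tendsto F atBot atTop

/-- Sub-relaxation: `(R̲F)(p) = sup_{q ≥ p} min (F q) (H q)`. -/
def subR (H F : ℝ → ℝ) (p : ℝ) : ℝ := sSup ((fun q => min (F q) (H q)) '' Ici p)

/-- Super-relaxation: `(R̄F)(p) = inf_{q ≤ p} max (F q) (H q)`. -/
def supR (H F : ℝ → ℝ) (p : ℝ) : ℝ := sInf ((fun q => max (F q) (H q)) '' Iic p)

/-- Relaxation operator: `R̲F` where `F ≥ H`, `R̄F` where `F ≤ H`. -/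
def relax (H F : ℝ → ℝ) (p : ℝ) : ℝ := if H p ≤ F p then subR H F p else supR H F p

/-- `p` is a negative characteristic point of `F` relative to `H`. -/
def negChar (H F : ℝ → ℝ) (p : ℝ) : Prop :=
  H p = F p ∧ ∃ ε > 0, ∀ q ∈ Ioo (p - ε) p, H q < H p

/-- `p` is a positive characteristic point of `F` relative to `H`. -/
def posChar (H F : ℝ → ℝ) (p : ℝ) : Prop :=
  H p = F p ∧ ∃ ε > 0, ∀ q ∈ Ioo p (p + ε), H p < H q

/-- The upper point `p⁺ ∈ ℝ ∪ {+∞}` associated with `p` and `H`. -/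
def upperPt (H : ℝ → ℝ) (p : ℝ) : EReal :=
  if ∀ ε > 0, ∃ q, p < q ∧ q < p + ε ∧ H q ≤ H p then (p : EReal)
  else sSup ((fun q : ℝ => (q : EReal)) '' {q : ℝ | p < q ∧ ∀ r ∈ Ioo p q, H p < H r})

/-- The lower point `p⁻` associated with `p` and `H`. -/
def lowerPt (H : ℝ → ℝ) (p : ℝ) : ℝ :=
  if ∀ ε > 0, ∃ q, p - ε < q ∧ q < p ∧ H p ≤ H q then p
  else sInf {q : ℝ | q < p ∧ ∀ r ∈ Ioo q p, H r < H p}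

/-- `p` is a positive limiter point of `F`. -/
def posLimiter (H F : ℝ → ℝ) (p : ℝ) : Prop :=
  (p : EReal) < upperPt H p ∧ F p ≤ H p ∧
    ∀ q : ℝ, H q < H p → F q ≤ H q →
      {r : ℝ | lowerPt H q < r ∧ (r : EReal) < upperPt H q} ∩
        {r : ℝ | p < r ∧ (r : EReal) < upperPt H p} = ∅

/-- `p` is a negative limiter point of `F`. -/
def negLimiter (H F : ℝ → ℝ) (p : ℝ) : Prop :=
  lowerPt H p < p ∧ H p ≤ F p ∧
    ∀ q : ℝ, H q ≤ F q → H p < H q →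
      {r : ℝ | lowerPt H q < r ∧ (r : EReal) < upperPt H q} ∩ Ioo (lowerPt H p) p = ∅

/-- The Godunov flux associated with `H`. -/
def godunov (H : ℝ → ℝ) (q p : ℝ) : ℝ :=
  if p ≤ q then sSup (H '' Icc p q) else sInf (H '' Icc q p)

/-- The lower (set-valued) Godunov semi-flux `G̲(q,p)`, as a subset of the extended reals. -/
def subG (H : ℝ → ℝ) (q p : ℝ) : Set EReal :=
  if q < p then {⊥}
  else if q = p then Iic ((H p : ℝ) : EReal)
  else {((godunov H q p : ℝ) : EReal)}

/-- The upper (set-valued) Godunov semi-flux `Ḡ(q,p)`, as a subset of the extended reals. -/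
def supG (H : ℝ → ℝ) (q p : ℝ) : Set EReal :=
  if q < p then {((godunov H q p : ℝ) : EReal)}
  else if q = p then Ici ((H p : ℝ) : EReal)
  else {⊤}

theorem aux_ac (m Φ : ℝ → ℝ) (hm : Continuous m)
    (h1 : ∀ p r, p ≤ r → m r ≤ Φ p) (h2 : ∀ p, ∃ r, p ≤ r ∧ Φ p = m r) :
    Antitone Φ ∧ Continuous Φ := by
  have ha : Antitone Φ := by
    intro a b hab
    obtain ⟨r, hr, e⟩ := h2 b
    rw [e]
    exact h1 a r (hab.trans hr)
  refine ⟨ha, ?_⟩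
  rw [Metric.continuous_iff]
  intro p0 ε hε
  obtain ⟨δ, hδ, hd⟩ := Metric.continuous_iff.1 hm p0 (ε/3) (by positivity)
  have key : ∀ p p', p ≤ p' → dist p p0 < δ → dist p' p0 < δ → Φ p ≤ Φ p' + 2 * (ε/3) := by
    intro p p' hpp hp hp'
    obtain ⟨r, hr, e⟩ := h2 p
    rcases le_total p' r with h | h
    · have := h1 p' r h
      linarith
    · have hr' : dist r p0 < δ := by
        rw [Real.dist_eq, abs_lt] at *
        constructor <;> linarith [hp.1, hp'.2]
      have a1 := hd r hr'
      have a2 := hd p' hp'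
      rw [Real.dist_eq, abs_lt] at a1 a2
      have := h1 p' p' le_rfl
      linarith [a1.2, a2.1]
  refine ⟨δ, hδ, fun p hp => ?_⟩
  have h0 : dist p0 p0 < δ := by simpa using hδ
  rw [Real.dist_eq, abs_lt]
  rcases le_total p p0 with h | h
  · have := key p p0 h hp h0
    have := ha h
    constructor <;> linarith
  · have := key p0 p h h0 hp
    have := ha h
    constructor <;> linarith

/-- Properties of `F0 G̲` and `F0 Ḡ`: non-increasing, continuous and semi-coercive. -/
theorem godunov_semi_flux_action_properties (H F0 Φ : ℝ → ℝ)
    (hH : Continuous H) (hHc : Coercive H)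
    (hF : Continuous F0) (hFa : Antitone F0) (hFs : SemiCoercive F0)
    (hΦ : (∀ p : ℝ, ∃ q : ℝ, Φ p = F0 q ∧ (F0 q : EReal) ∈ subG H q p) ∨
          (∀ p : ℝ, ∃ q : ℝ, Φ p = F0 q ∧ (F0 q : EReal) ∈ supG H q p)) :
    Antitone Φ ∧ Continuous Φ ∧ SemiCoercive Φ := by
  rcases hΦ with hΦ | hΦ
  · have h1 : ∀ p r, p ≤ r → min (F0 r) (H r) ≤ Φ p := by
      intro p r hr
      obtain ⟨q, e, hq⟩ := hΦ p
      rw [e]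
      unfold subG at hq
      split_ifs at hq with c1 c2
      · simp at hq
      · subst c2
        exact (min_le_left _ _).trans (hFa hr)
      · have hpq : p ≤ q := not_lt.1 c1
        have hq' : F0 q = sSup (H '' Icc p q) := by
          simpa [godunov, hpq] using hq
        rcases le_total q r with h | h
        · exact (min_le_left _ _).trans (hFa h)
        · refine (min_le_right _ _).trans ?_
          rw [hq']
          exact le_csSup (isCompact_Icc.image hH).bddAbove ⟨r, ⟨hr, h⟩, rfl⟩
    have h2 : ∀ p, ∃ r, p ≤ r ∧ Φ p = min (F0 r) (H r) := by
      intro p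
      obtain ⟨q, e, hq⟩ := hΦ p
      rw [e]
      unfold subG at hq
      split_ifs at hq with c1 c2
      · simp at hq
      · subst c2
        have : F0 q ≤ H q := by simpa using hq
        exact ⟨q, le_rfl, (min_eq_left this).symm⟩
      · have hpq : p ≤ q := not_lt.1 c1
        have hq' : F0 q = sSup (H '' Icc p q) := by
          simpa [godunov, hpq] using hq
        obtain ⟨r, hr, er⟩ := (isCompact_Icc.image hH).sSup_mem ((nonempty_Icc.2 hpq).image H)
        refine ⟨r, hr.1, ?_⟩
        rw [er, ← hq', min_eq_right (hFa hr.2)]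
    obtain ⟨a, b⟩ := aux_ac _ Φ (hF.min hH) h1 h2
    refine ⟨a, b, ?_⟩
    have hHb : Tendsto H atBot atTop := hHc.mono_left atBot_le_cocompact
    unfold SemiCoercive at *
    rw [tendsto_atTop] at *
    intro c
    filter_upwards [hFs c, hHb c] with p u v
    exact (le_min u v).trans (h1 p p le_rfl)
  · have h1 : ∀ p r, r ≤ p → Φ p ≤ max (F0 r) (H r) := by
      intro p r hr
      obtain ⟨q, e, hq⟩ := hΦ p
      rw [e]
      unfold supG at hq
      split_ifs at hq with c1 c2
      · have hq' : F0 q = sInf (H '' Icc q p) := by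
          simpa [godunov, not_le.2 c1] using hq
        rcases le_total r q with h | h
        · exact (hFa h).trans (le_max_left _ _)
        · refine le_trans ?_ (le_max_right _ _)
          rw [hq']
          exact csInf_le (isCompact_Icc.image hH).bddBelow ⟨r, ⟨h, hr⟩, rfl⟩
      · subst c2
        exact (hFa hr).trans (le_max_left _ _)
      · simp at hq
    have h2 : ∀ p, ∃ r, r ≤ p ∧ Φ p = max (F0 r) (H r) := by
      intro p
      obtain ⟨q, e, hq⟩ := hΦ p
      rw [e]
      unfold supG at hq
      split_ifs at hq with c1 c2
      · have hq' : F0 q = sInf (H '' Icc q p) := by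
          simpa [godunov, not_le.2 c1] using hq
        obtain ⟨r, hr, er⟩ := (isCompact_Icc.image hH).sInf_mem ((nonempty_Icc.2 c1.le).image H)
        refine ⟨r, hr.2, ?_⟩
        rw [er, ← hq', max_eq_right (hFa hr.1)]
      · subst c2
        have : H q ≤ F0 q := by simpa using hq
        exact ⟨q, le_rfl, (max_eq_left this).symm⟩
      · simp at hq
    obtain ⟨a, b⟩ := aux_ac (fun x => - max (F0 (-x)) (H (-x))) (fun x => - Φ (-x))
      (((hF.comp continuous_neg).max (hH.comp continuous_neg)).neg)
      (fun p r h => neg_le_neg (h1 (-p) (-r) (neg_le_neg h)))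
      (fun p => by
        obtain ⟨r, hr, e⟩ := h2 (-p)
        exact ⟨-r, by linarith, by simp [e]⟩)
    refine ⟨?_, ?_, ?_⟩
    · intro x y h
      have := a (neg_le_neg h)
      simpa using this
    · have := (b.comp continuous_neg).neg
      have e : (fun x => -((fun x => -Φ (-x)) ∘ Neg.neg) x) = Φ := by
        funext x
        simp
      rw [← e]
      exact this
    · refine tendsto_atTop_mono (fun p => ?_) hFs
      obtain ⟨r, hr, e⟩ := h2 p
      rw [e]
      exact (hFa hr).trans (le_max_left _ _)
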